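/- Let S ⊂ ℝ₊ⁿ be compact convex with 0 ∈ S, let K be a compact Reinhardt set with A = Log(K ∩ (ℂ*)ⁿ) nonempty, and assume K = closure(K ∩ (ℂ*)ⁿ). Then for every z ∈ (ℂ*)ⁿ, the Siciak–Zakharyuta function satisfies V^S_K(z) = sup_{s∈S} (⟨s, Log z⟩ − φ_A(s)), where φ_A(s) = sup_{a∈A} ⟨a,s⟩ and V^S_K(z) = sup{u(z) : u ∈ L^S(ℂⁿ), u ≤ 0 on K}. -/

import Mathlib

open scoped BigOperators

noncomputable section

/-- Plurisubharmonicity of a (real-valued) function on ℂⁿ: upper semicontinuity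
    together with the sub-mean-value inequality on every complex line and circle. -/
def Plurisubharmonic {n : ℕ} (u : (Fin n → ℂ) → ℝ) : Prop :=
  UpperSemicontinuous u ∧
  ∀ (a w : Fin n → ℂ) (r : ℝ), 0 < r →
    u a ≤ (2 * Real.pi)⁻¹ *
      ∫ θ in (0:ℝ)..(2 * Real.pi), u (a + ((r : ℂ) * Complex.exp (θ * Complex.I)) • w)

/-- The Euclidean dot product on Fin n → ℝ. -/
def dotp {n : ℕ} (x y : Fin n → ℝ) : ℝ := ∑ i, x i * y i

/-- Logarithmic coordinates Log z = (log|z₁|,…,log|zₙ|). -/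
def LogC {n : ℕ} (z : Fin n → ℂ) : Fin n → ℝ := fun i => Real.log ‖z i‖

/-- The class L^S(ℂⁿ): psh functions u with u ≤ H_S + c on (ℂ*)ⁿ,
    where H_S(z) = sup_{s ∈ S} ⟨s, Log z⟩. -/
def MemLS {n : ℕ} (S : Set (Fin n → ℝ)) (u : (Fin n → ℂ) → ℝ) : Prop :=
  Plurisubharmonic u ∧ ∃ c : ℝ, ∀ z : Fin n → ℂ, (∀ i, z i ≠ 0) →
    u z ≤ sSup ((fun s => dotp s (LogC z)) '' S) + c

/-- The Siciak–Zakharyuta function V^S_K. -/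
def VSZ {n : ℕ} (S : Set (Fin n → ℝ)) (K : Set (Fin n → ℂ))
    (z : Fin n → ℂ) : ℝ :=
  sSup {t : ℝ | ∃ u, MemLS S u ∧ (∀ w ∈ K, u w ≤ 0) ∧ t = u z}

open MeasureTheory Set

lemma abs_log_norm_one_add_sub_re_le {z : ℂ} (hz : ‖z‖ ≤ 1 / 2) :
    |Real.log ‖1 + z‖ - z.re| ≤ ‖z‖ ^ 2 := by
  have h := Complex.norm_log_one_add_sub_self_le (z := z) (by linarith)
  have h1 : |(Complex.log (1 + z) - z).re| ≤ ‖Complex.log (1 + z) - z‖ := Complex.abs_re_le_norm _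
  rw [Complex.sub_re, Complex.log_re] at h1
  have h2 : (1 - ‖z‖)⁻¹ ≤ 2 := by
    rw [inv_le_comm₀ (by linarith) (by norm_num)]
    linarith
  nlinarith [sq_nonneg ‖z‖]

lemma integral_log_norm_one_add_mul_exp {c : ℝ} (hc : |c| ≤ 1) :
    ∫ θ in (0 : ℝ)..(2 * Real.pi), Real.log ‖1 + (c : ℂ) * Complex.exp (θ * Complex.I)‖ = 0 := by
  rcases eq_or_ne c 0 with rfl | hc0
  · simp
  have h := circleAverage_log_norm_sub_const_eq_log_radius_add_posLog (a := 0) (c := 1) hc0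
  have h2 : Real.log c ≤ 0 := by
    rw [← Real.log_abs]
    exact Real.log_nonpos (abs_nonneg _) hc
  have h3 : Real.posLog (c⁻¹ * ‖(1 : ℂ) - 0‖) = - Real.log c := by
    simp [Real.posLog, h2]
  rw [h3, add_neg_cancel, Real.circleAverage_def, smul_eq_mul] at h
  have h4 : (2 * Real.pi)⁻¹ ≠ 0 := by positivity
  simpa [circleMap] using (mul_eq_zero.1 h).resolve_left h4

lemma ae_add_circle_smul_ne_zero {a : ℂ} (ha : a ≠ 0) (w : ℂ) (r : ℝ) :
    ∀ᵐ θ : ℝ, a + (r * Complex.exp (θ * Complex.I)) * w ≠ 0 := by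
  rw [ae_iff]
  refine Set.Countable.measure_zero ?_ _
  by_cases hne : {θ : ℝ | ¬ (a + (r * Complex.exp (θ * Complex.I)) * w ≠ 0)}.Nonempty
  · obtain ⟨t, ht⟩ := hne
    refine (Set.countable_range (fun k : ℤ => t + k * (2 * Real.pi))).mono ?_
    intro θ hθ
    simp only [ne_eq, not_not, Set.mem_ofPred_eq] at ht hθ
    have hrw : (r : ℂ) * w ≠ 0 := by
      intro h0
      apply ha
      linear_combination ht - Complex.exp (t * Complex.I) * h0
    have he : Complex.exp (θ * Complex.I) = Complex.exp (t * Complex.I) := by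
      apply mul_left_cancel₀ hrw
      linear_combination hθ - ht
    obtain ⟨k, hk⟩ := Complex.exp_eq_exp_iff_exists_int.1 he
    refine ⟨k, ?_⟩
    have h5 : (θ : ℂ) = t + k * (2 * Real.pi) := by
      apply mul_right_cancel₀ Complex.I_ne_zero
      linear_combination hk
    exact_mod_cast h5.symm
  · rw [Set.not_nonempty_iff_eq_empty] at hne
    rw [hne]
    exact Set.countable_empty

lemma intervalIntegrable_log_norm_circle (a w : ℂ) (r : ℝ) :
    IntervalIntegrable (fun θ : ℝ => Real.log ‖a + (r * Complex.exp (θ * Complex.I)) * w‖)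
      volume 0 (2 * Real.pi) := by
  have h : CircleIntegrable (fun x : ℂ => Real.log ‖a + x * w‖) 0 r :=
    MeromorphicOn.circleIntegrable_log_norm (fun z _ => by fun_prop)
  simpa [CircleIntegrable, circleMap] using h

lemma log_norm_le_integral_circle {a : ℂ} (ha : a ≠ 0) (w : ℂ) {r : ℝ} (hr : 0 < r) :
    2 * Real.pi * Real.log ‖a‖ ≤
      ∫ θ in (0 : ℝ)..(2 * Real.pi), Real.log ‖a + (r * Complex.exp (θ * Complex.I)) * w‖ := by
  rcases eq_or_ne w 0 with rfl | hw
  · simp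
  have h := circleAverage_log_norm_sub_const_eq_log_radius_add_posLog (a := -(a / w)) (c := 0)
    hr.ne'
  rw [Real.circleAverage_def, smul_eq_mul, zero_sub, neg_neg] at h
  have hint : IntervalIntegrable (fun θ : ℝ => Real.log ‖circleMap 0 r θ - -(a / w)‖)
      volume 0 (2 * Real.pi) := circleIntegrable_log_norm_sub_const r
  have hcongr : ∫ θ in (0 : ℝ)..(2 * Real.pi),
      Real.log ‖a + (r * Complex.exp (θ * Complex.I)) * w‖ =
      ∫ θ in (0 : ℝ)..(2 * Real.pi), (Real.log ‖w‖ + Real.log ‖circleMap 0 r θ - -(a / w)‖) := by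
    apply intervalIntegral.integral_congr_ae
    filter_upwards [ae_add_circle_smul_ne_zero ha w r] with θ hθ _
    have he : a + (r * Complex.exp (θ * Complex.I)) * w = w * (circleMap 0 r θ - -(a / w)) := by
      simp only [circleMap]
      field_simp
      ring
    rw [he] at hθ ⊢
    rw [norm_mul, Real.log_mul (norm_ne_zero_iff.2 hw) (norm_ne_zero_iff.2 (right_ne_zero_of_mul hθ))]
  rw [hcongr, intervalIntegral.integral_add (by simp) hint]
  have hpi : (0 : ℝ) < 2 * Real.pi := by positivity
  rw [inv_mul_eq_iff_eq_mul₀ hpi.ne'] at h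
  rw [h, intervalIntegral.integral_const, smul_eq_mul, sub_zero, ← mul_add]
  apply mul_le_mul_of_nonneg_left _ hpi.le
  have hlog : Real.log (r⁻¹ * ‖a / w‖) = Real.log ‖a‖ - Real.log ‖w‖ - Real.log r := by
    rw [norm_div, Real.log_mul (by positivity) (by positivity), Real.log_div (by positivity)
      (by positivity), Real.log_inv]
    ring
  have : Real.log (r⁻¹ * ‖a / w‖) ≤ Real.posLog (r⁻¹ * ‖a / w‖) := le_max_right _ _
  linarith

/-- The positive part of a plurisubharmonic function satisfies the sub-mean-value inequality. -/
lemma Plurisubharmonic.posPart_le_integral {n : ℕ} {u : (Fin n → ℂ) → ℝ}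
    (hu : Plurisubharmonic u) (a w : Fin n → ℂ) {r : ℝ} (hr : 0 < r) :
    2 * Real.pi * max (u a) 0 ≤
      ∫ θ in (0 : ℝ)..(2 * Real.pi),
        max (u (a + ((r : ℂ) * Complex.exp (θ * Complex.I)) • w)) 0 := by
  have hpi : (0 : ℝ) < 2 * Real.pi := by positivity
  have hnn : 0 ≤ ∫ θ in (0 : ℝ)..(2 * Real.pi),
      max (u (a + ((r : ℂ) * Complex.exp (θ * Complex.I)) • w)) 0 :=
    intervalIntegral.integral_nonneg hpi.le fun _ _ => le_max_right _ _
  have h := hu.2 a w r hr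
  rw [le_inv_mul_iff₀ hpi] at h
  rcases le_total (u a) 0 with h0 | h0
  · simpa [max_eq_right h0] using hnn
  rw [max_eq_left h0]
  refine h.trans ?_
  by_cases hi : IntervalIntegrable (fun θ : ℝ =>
      u (a + ((r : ℂ) * Complex.exp (θ * Complex.I)) • w)) volume 0 (2 * Real.pi)
  · refine intervalIntegral.integral_mono hpi.le hi ?_ fun θ => le_max_left _ _
    exact ⟨hi.1.pos_part, hi.2.pos_part⟩
  · rwa [intervalIntegral.integral_undef hi]

open Filter Topology

lemma IsCompact.exists_forall_le_mul {X : Type*} [TopologicalSpace X] {B : Set X}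
    (hB : IsCompact B) {f N : X → ℝ} (hf : UpperSemicontinuousOn f B) (hN : ContinuousOn N B)
    (hpos : ∀ x ∈ B, 0 < N x) : ∃ C : ℝ, 0 ≤ C ∧ ∀ x ∈ B, f x ≤ C * N x := by
  rcases B.eq_empty_or_nonempty with rfl | hne
  · exact ⟨0, le_rfl, by simp⟩
  obtain ⟨a, ha, hmax⟩ := hf.exists_isMaxOn hne hB
  obtain ⟨m, hm, hmin⟩ := hB.exists_isMinOn hne hN
  refine ⟨max (f a) 0 / N m, div_nonneg (le_max_right _ _) (hpos m hm).le, fun x hx => ?_⟩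
  calc f x ≤ max (f a) 0 := (hmax hx).trans (le_max_left _ _)
    _ = max (f a) 0 / N m * N m := by rw [div_mul_cancel₀ _ (hpos m hm).ne']
    _ ≤ _ := mul_le_mul_of_nonneg_left (hmin hx)
      (div_nonneg (le_max_right _ _) (hpos m hm).le)

/-- The deviation of `log |1 + r b e^{iθ}|` from its first order term. -/
def logErr (r b θ : ℝ) : ℝ :=
  Real.log ‖(1 : ℂ) + (r * Complex.exp (θ * Complex.I)) * b‖ - r * b * Real.cos θ

lemma abs_logErr_le {r b : ℝ} (h : |r * b| ≤ 1 / 2) (θ : ℝ) : |logErr r b θ| ≤ (r * b) ^ 2 := by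
  have hn : ‖((r : ℂ) * Complex.exp (θ * Complex.I)) * b‖ = |r * b| := by
    simp [Complex.norm_exp_ofReal_mul_I, abs_mul]
  have hre : (((r : ℂ) * Complex.exp (θ * Complex.I)) * b).re = r * b * Real.cos θ := by
    rw [show ((r : ℂ) * Complex.exp (θ * Complex.I)) * b
      = ((r * b : ℝ) : ℂ) * Complex.exp (θ * Complex.I) by push_cast; ring, Complex.re_ofReal_mul,
      Complex.exp_ofReal_mul_I_re]
  have := abs_log_norm_one_add_sub_re_le (hn.trans_le h)
  rwa [hre, hn, sq_abs] at this

lemma intervalIntegrable_logErr (r b : ℝ) :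
    IntervalIntegrable (logErr r b) volume 0 (2 * Real.pi) :=
  (intervalIntegrable_log_norm_circle 1 b r).sub
    (Continuous.intervalIntegrable (by fun_prop) _ _)

lemma integral_logErr {r b : ℝ} (h : |r * b| ≤ 1 / 2) :
    ∫ θ in (0 : ℝ)..(2 * Real.pi), logErr r b θ = 0 := by
  unfold logErr
  rw [intervalIntegral.integral_sub (intervalIntegrable_log_norm_circle 1 b r)
    (Continuous.intervalIntegrable (by fun_prop) _ _)]
  have h1 := integral_log_norm_one_add_mul_exp (c := r * b) (by linarith)
  have h2 : ∀ θ : ℝ, (1 : ℂ) + (r * Complex.exp (θ * Complex.I)) * b =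
      1 + ((r * b : ℝ) : ℂ) * Complex.exp (θ * Complex.I) := fun θ => by push_cast; ring
  simp only [h2, h1]
  simp

/-- A plurisubharmonic function cannot be touched from above at `z` by a function of the logarithmic
coordinates that is strictly concave in the direction `b`. -/
lemma Plurisubharmonic.not_eventually_le {n : ℕ} {u : (Fin n → ℂ) → ℝ}
    (hu : Plurisubharmonic u) (z : Fin n → ℂ) (b y : Fin n → ℝ) {κ ε C : ℝ} (hε : 0 < ε)
    (hC : 0 ≤ C) :
    ¬ ∀ᶠ r : ℝ in 𝓝[>] 0, ∀ θ : ℝ,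
      max (u (z + ((r : ℂ) * Complex.exp (θ * Complex.I)) • fun i => (b i : ℂ) * z i)) 0 ≤
        max (u z) 0 + κ * (r * Real.cos θ) - ε * (r * Real.cos θ) ^ 2 +
          C * ∑ i, ((y i + logErr r (b i) θ) ^ 2 - y i ^ 2) := by
  intro h
  have hpi : (0 : ℝ) < 2 * Real.pi := by positivity
  have hb : ∀ᶠ r : ℝ in 𝓝[>] 0, ∀ i, |r * b i| ≤ 1 / 2 := by
    rw [eventually_all]
    intro i
    have : Tendsto (fun r : ℝ => |r * b i|) (𝓝[>] 0) (𝓝 |0 * b i|) :=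
      (Continuous.tendsto (by fun_prop) _).mono_left nhdsWithin_le_nhds
    exact this.eventually_le_const (by norm_num)
  have hs : ∀ᶠ r : ℝ in 𝓝[>] 0, C * ∑ i, r ^ 2 * b i ^ 4 < ε / 2 := by
    have : Tendsto (fun r : ℝ => C * ∑ i, r ^ 2 * b i ^ 4) (𝓝[>] 0)
        (𝓝 (C * ∑ i, (0 : ℝ) ^ 2 * b i ^ 4)) :=
      (Continuous.tendsto (by fun_prop) _).mono_left nhdsWithin_le_nhds
    exact this.eventually_lt_const (by simpa using hε)
  obtain ⟨r, hr, hrb, hrs, hr0⟩ := (h.and (hb.and (hs.and self_mem_nhdsWithin))).exists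
  replace hr0 : 0 < r := hr0
  have hsub := hu.posPart_le_integral z (fun i => (b i : ℂ) * z i) hr0
  set v := max (u z) 0
  have hcos : IntervalIntegrable (fun θ : ℝ => v + κ * (r * Real.cos θ) -
      ε * (r * Real.cos θ) ^ 2) volume 0 (2 * Real.pi) :=
    Continuous.intervalIntegrable (by fun_prop) _ _
  have hterm : ∀ i, IntervalIntegrable
      (fun θ : ℝ => 2 * y i * logErr r (b i) θ + (r * b i) ^ 4) volume 0 (2 * Real.pi) := fun i =>
    ((intervalIntegrable_logErr r (b i)).const_mul _).add (by simp)
  have hsum : IntervalIntegrable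
      (fun θ : ℝ => C * ∑ i, (2 * y i * logErr r (b i) θ + (r * b i) ^ 4))
      volume 0 (2 * Real.pi) := by
    apply IntervalIntegrable.const_mul
    have := IntervalIntegrable.sum Finset.univ (fun i _ => hterm i)
    simpa [Finset.sum_fn] using this
  have hle : ∫ θ in (0 : ℝ)..(2 * Real.pi),
      max (u (z + ((r : ℂ) * Complex.exp (θ * Complex.I)) • fun i => (b i : ℂ) * z i)) 0 ≤
      ∫ θ in (0 : ℝ)..(2 * Real.pi), ((v + κ * (r * Real.cos θ) - ε * (r * Real.cos θ) ^ 2) +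
        C * ∑ i, (2 * y i * logErr r (b i) θ + (r * b i) ^ 4)) := by
    rw [intervalIntegral.integral_of_le hpi.le, intervalIntegral.integral_of_le hpi.le]
    refine integral_mono_of_nonneg (ae_of_all _ fun θ => le_max_right _ _) (hcos.add hsum).1
      (ae_of_all _ fun θ => (hr θ).trans
        (add_le_add le_rfl (mul_le_mul_of_nonneg_left (Finset.sum_le_sum fun i _ => ?_) hC)))
    have h1 := abs_logErr_le (hrb i) θ
    have h2 : logErr r (b i) θ ^ 2 ≤ (r * b i) ^ 4 := by
      calc logErr r (b i) θ ^ 2 = |logErr r (b i) θ| ^ 2 := (sq_abs _).symm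
        _ ≤ ((r * b i) ^ 2) ^ 2 := by gcongr
        _ = _ := by ring
    nlinarith
  have hval : ∫ θ in (0 : ℝ)..(2 * Real.pi),
      ((v + κ * (r * Real.cos θ) - ε * (r * Real.cos θ) ^ 2) +
        C * ∑ i, (2 * y i * logErr r (b i) θ + (r * b i) ^ 4)) =
      2 * Real.pi * v - ε * r ^ 2 * Real.pi + C * ∑ i, 2 * Real.pi * (r * b i) ^ 4 := by
    rw [intervalIntegral.integral_add hcos hsum, intervalIntegral.integral_const_mul,
      intervalIntegral.integral_finsetSum (fun i _ => hterm i)]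
    congr 1
    · rw [intervalIntegral.integral_sub (Continuous.intervalIntegrable (by fun_prop) _ _)
        (Continuous.intervalIntegrable (by fun_prop) _ _),
        intervalIntegral.integral_add (Continuous.intervalIntegrable (by fun_prop) _ _)
        (Continuous.intervalIntegrable (by fun_prop) _ _)]
      simp only [mul_pow, intervalIntegral.integral_const_mul, integral_cos_sq, integral_cos]
      simp
      ring
    · congr 1
      refine Finset.sum_congr rfl fun i _ => ?_
      rw [intervalIntegral.integral_add ((intervalIntegrable_logErr r (b i)).const_mul _)
        (by simp), intervalIntegral.integral_const_mul, integral_logErr (hrb i)]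
      simp
  have hfac : C * ∑ i, 2 * Real.pi * (r * b i) ^ 4 =
      2 * Real.pi * r ^ 2 * (C * ∑ i, r ^ 2 * b i ^ 4) := by
    simp only [Finset.mul_sum]
    exact Finset.sum_congr rfl fun i _ => by ring
  have hk : 0 < 2 * Real.pi * r ^ 2 := by positivity
  have := mul_lt_mul_of_pos_left hrs hk
  have h3 := hsub.trans hle
  rw [hval, hfac] at h3
  linarith

/-- A plurisubharmonic function bounded by `α` and `β` on the tori over `p` and `q` in logarithmic
coordinates is bounded by the affine interpolation on the tori over the segment from `p` to `q`. -/
lemma Plurisubharmonic.posPart_le_lineMap {n : ℕ} {u : (Fin n → ℂ) → ℝ}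
    (hu : Plurisubharmonic u) {p q : Fin n → ℝ} {α β : ℝ}
    (hp : ∀ z : Fin n → ℂ, (∀ i, ‖z i‖ = Real.exp (p i)) → max (u z) 0 ≤ α)
    (hq : ∀ z : Fin n → ℂ, (∀ i, ‖z i‖ = Real.exp (q i)) → max (u z) 0 ≤ β)
    {t : ℝ} (ht0 : 0 ≤ t) (ht1 : t ≤ 1) {z : Fin n → ℂ}
    (hz : ∀ i, ‖z i‖ = Real.exp (p i + t * (q i - p i))) :
    max (u z) 0 ≤ (1 - t) * α + t * β := by
  by_contra! hlt
  obtain ⟨G, hG⟩ : ∃ G, G = max (u z) 0 - ((1 - t) * α + t * β) := ⟨_, rfl⟩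
  have hG0 : 0 < G := by linarith
  let D : Set (ℝ × (Fin n → ℝ) × (Fin n → ℂ)) := {x | (0 ≤ x.1 ∧ x.1 ≤ 1) ∧
    (∀ i, |x.2.1 i| ≤ 1) ∧ ∀ i, ‖x.2.2 i‖ = Real.exp (p i + x.1 * (q i - p i) + x.2.1 i)}
  have hDclosed : IsClosed D := by
    have h2 : IsClosed {x : ℝ × (Fin n → ℝ) × (Fin n → ℂ) | ∀ i, |x.2.1 i| ≤ 1} := by
      rw [Set.ofPred_forall]
      exact isClosed_iInter fun i => isClosed_le (by fun_prop) (by fun_prop)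
    have h3 : IsClosed {x : ℝ × (Fin n → ℝ) × (Fin n → ℂ) |
        ∀ i, ‖x.2.2 i‖ = Real.exp (p i + x.1 * (q i - p i) + x.2.1 i)} := by
      rw [Set.ofPred_forall]
      exact isClosed_iInter fun i => isClosed_eq (by fun_prop) (by fun_prop)
    exact ((isClosed_le continuous_const continuous_fst).inter
      (isClosed_le continuous_fst continuous_const)).inter (h2.inter h3)
  have hD : IsCompact D := by
    refine IsCompact.of_isClosed_subset (isCompact_Icc.prod ((isCompact_univ_pi
      fun i => isCompact_Icc (a := (-1 : ℝ)) (b := 1)).prod (isCompact_univ_pi fun i =>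
      isCompact_closedBall (0 : ℂ) (Real.exp (|p i| + |q i - p i| + 1))))) hDclosed
      (s := Icc (0 : ℝ) 1 ×ˢ _) ?_
    rintro ⟨τ, y, ζ⟩ ⟨⟨h0, h1⟩, hy, hζ⟩
    refine ⟨⟨h0, h1⟩, fun i _ => abs_le.1 (hy i), fun i _ => ?_⟩
    rw [mem_closedBall_zero_iff, hζ i, Real.exp_le_exp]
    have hy' := (le_abs_self _).trans (hy i)
    have h2 : τ * (q i - p i) ≤ |q i - p i| := by
      nlinarith [le_abs_self (q i - p i), abs_nonneg (q i - p i)]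
    have h3 := le_abs_self (p i)
    dsimp only at hy' ⊢
    linarith
  have husc : UpperSemicontinuous fun x : ℝ × (Fin n → ℝ) × (Fin n → ℂ) => max (u x.2.2) 0 :=
    (hu.1.comp (by fun_prop : Continuous
      fun x : ℝ × (Fin n → ℝ) × (Fin n → ℂ) => x.2.2)).sup continuous_const.upperSemicontinuous
  have hf : UpperSemicontinuous fun x : ℝ × (Fin n → ℝ) × (Fin n → ℂ) =>
      max (u x.2.2) 0 + (-((1 - x.1) * α + x.1 * β) - G / 4) :=
    husc.add (Continuous.upperSemicontinuous (by fun_prop))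
  let B : Set (ℝ × (Fin n → ℝ) × (Fin n → ℂ)) := D ∩
    ({x | 0 ≤ max (u x.2.2) 0 + (-((1 - x.1) * α + x.1 * β) - G / 4)} ∩
      {x | x.1 * (1 - x.1) * ∏ i, (1 - x.2.1 i ^ 2) = 0})
  have hB : IsCompact B := hD.inter_right
    ((hf.isClosed_preimage 0).inter (isClosed_eq (by fun_prop) continuous_const))
  obtain ⟨C, hC0, hC⟩ := hB.exists_forall_le_mul (hf.upperSemicontinuousOn B)
    (N := fun x => ∑ i, x.2.1 i ^ 2) (by fun_prop) (by
      rintro ⟨τ, y, ζ⟩ ⟨⟨-, hy, hζ⟩, hfx, hbd⟩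
      refine lt_of_le_of_ne (Finset.sum_nonneg fun i _ => sq_nonneg _) fun h0 => ?_
      rw [eq_comm, Finset.sum_eq_zero_iff_of_nonneg fun i _ => sq_nonneg _] at h0
      have hy0 : ∀ i, y i = 0 := fun i => by simpa using h0 i (Finset.mem_univ i)
      simp only [Set.mem_ofPred_eq, hy0] at hbd hfx hζ
      have hτ : τ = 0 ∨ τ = 1 := by
        simpa [sub_eq_zero, eq_comm (a := (1 : ℝ))] using hbd
      rcases hτ with rfl | rfl
      · have := hp ζ fun i => by simpa using hζ i
        linarith
      · have := hq ζ fun i => by simpa using hζ i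
        linarith)
  have hF : UpperSemicontinuous fun x : ℝ × (Fin n → ℝ) × (Fin n → ℂ) =>
      max (u x.2.2) 0 + (-((1 - x.1) * α + x.1 * β) - G / 2 * (x.1 * (1 - x.1))
        - C * ∑ i, x.2.1 i ^ 2) :=
    husc.add (Continuous.upperSemicontinuous (by fun_prop))
  have hmemz : (t, (0 : Fin n → ℝ), z) ∈ D :=
    ⟨⟨ht0, ht1⟩, by simp, fun i => by simpa using hz i⟩
  obtain ⟨⟨τ, y, ζ⟩, hxD, hmax⟩ := (hF.upperSemicontinuousOn D).exists_isMaxOn ⟨_, hmemz⟩ hD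
  obtain ⟨⟨hτ0, hτ1⟩, hy, hζ⟩ := hxD
  dsimp only at hτ0 hτ1 hy hζ
  have hge := hmax hmemz
  simp only [Set.mem_ofPred_eq, Pi.zero_apply] at hge
  have hint : τ * (1 - τ) * ∏ i, (1 - y i ^ 2) ≠ 0 := by
    intro h0
    have hN : 0 ≤ C * ∑ i, y i ^ 2 := mul_nonneg hC0 (Finset.sum_nonneg fun i _ => sq_nonneg _)
    have h1 : max (u ζ) 0 + (-((1 - τ) * α + τ * β) - G / 4) ≤ C * ∑ i, y i ^ 2 := by
      by_cases h2 : 0 ≤ max (u ζ) 0 + (-((1 - τ) * α + τ * β) - G / 4)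
      · exact hC (τ, y, ζ) ⟨⟨⟨hτ0, hτ1⟩, hy, hζ⟩, h2, h0⟩
      · linarith
    have h3 : 0 ≤ G / 2 * (τ * (1 - τ)) := by
      have := sub_nonneg.2 hτ1
      positivity
    have h4 : G / 2 * (t * (1 - t)) ≤ G / 2 * 1 :=
      mul_le_mul_of_nonneg_left (by nlinarith) (by linarith)
    simp at hge
    linarith
  have hτ0' : 0 < τ := lt_of_le_of_ne hτ0 fun h => hint (by simp [← h])
  have hτ1' : 0 < 1 - τ := lt_of_le_of_ne (by linarith) fun h => hint (by simp [← h])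
  have hy' : ∀ i, 0 < 1 - |y i| := fun i => by
    refine lt_of_le_of_ne (by linarith [hy i]) fun h => hint ?_
    rw [Finset.prod_eq_zero (Finset.mem_univ i), mul_zero]
    rw [← sq_abs, show |y i| = 1 by linarith]
    norm_num
  refine hu.not_eventually_le ζ (fun i => q i - p i) y (κ := (β - α) + G / 2 * (1 - 2 * τ))
    (ε := G / 2) (by linarith) hC0 ?_
  have hcont : ∀ f : ℝ → ℝ, Continuous f → ∀ c, f 0 < c → ∀ᶠ r in 𝓝[>] (0 : ℝ), f r < c :=
    fun f hf c hc => ((hf.tendsto 0).mono_left nhdsWithin_le_nhds).eventually_lt_const hc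
  filter_upwards [self_mem_nhdsWithin, hcont (fun r => r) continuous_id _ hτ0',
    hcont (fun r => r) continuous_id _ hτ1',
    eventually_all.2 fun i => hcont (fun r => |r * (q i - p i)|) (by fun_prop) (1 / 2) (by simp),
    eventually_all.2 fun i => hcont (fun r => (r * (q i - p i)) ^ 2) (by fun_prop) (1 - |y i|)
      (by simpa using hy' i)] with r hr0 hr1 hr2 hr3 hr4 θ
  replace hr0 : 0 < r := hr0
  have hc1 : r * Real.cos θ ≤ r := by nlinarith [Real.cos_le_one θ]
  have hc2 : -r ≤ r * Real.cos θ := by nlinarith [Real.neg_one_le_cos θ]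
  have hmem : (τ + r * Real.cos θ, (fun i => y i + logErr r (q i - p i) θ),
      ζ + ((r : ℂ) * Complex.exp (θ * Complex.I)) •
        fun i => ((q i - p i : ℝ) : ℂ) * ζ i) ∈ D := by
    refine ⟨⟨by dsimp only; linarith, by dsimp only; linarith⟩, fun i => ?_, fun i => ?_⟩
    · have := abs_logErr_le (hr3 i).le θ
      have h5 := abs_add_le (y i) (logErr r (q i - p i) θ)
      have := hr4 i
      dsimp only
      linarith
    · have hne : (1 : ℂ) + (r * Complex.exp (θ * Complex.I)) * ((q i - p i : ℝ) : ℂ) ≠ 0 := by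
        intro h0
        have hn : ‖((r : ℂ) * Complex.exp (θ * Complex.I)) * ((q i - p i : ℝ) : ℂ)‖
            = |r * (q i - p i)| := by
          rw [norm_mul, norm_mul, Complex.norm_exp_ofReal_mul_I, Complex.norm_real,
            Complex.norm_real, mul_one, abs_mul, Real.norm_eq_abs, Real.norm_eq_abs]
        rw [eq_neg_of_add_eq_zero_right h0, norm_neg, norm_one] at hn
        have := hr3 i
        linarith
      have hfac : ζ i + ((r : ℂ) * Complex.exp (θ * Complex.I)) * (((q i - p i : ℝ) : ℂ) * ζ i)
          = ζ i * (1 + (r * Complex.exp (θ * Complex.I)) * ((q i - p i : ℝ) : ℂ)) := by ring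
      simp only [Pi.add_apply, Pi.smul_apply, smul_eq_mul]
      rw [hfac, norm_mul, hζ i, ← Real.exp_log (norm_pos_iff.2 hne), ← Real.exp_add]
      congr 1
      simp only [logErr]
      ring
  have h6 := hmax hmem
  simp only [Set.mem_ofPred_eq] at h6
  rw [Finset.sum_sub_distrib]
  nlinarith

lemma log_mul_prod_rpow {n : ℕ} {c : ℝ} (hc : 0 < c) {s : Fin n → ℝ} {x : Fin n → ℂ}
    (hx : ∀ i, s i ≠ 0 → x i ≠ 0) :
    Real.log (c * ∏ i, ‖x i‖ ^ s i) = Real.log c + ∑ i, s i * Real.log ‖x i‖ := by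
  have hpos : ∀ i, 0 < ‖x i‖ ^ s i := fun i => by
    by_cases h : s i = 0
    · simp [h]
    · exact Real.rpow_pos_of_pos (norm_pos_iff.2 (hx i h)) _
  rw [Real.log_mul hc.ne' (Finset.prod_pos fun i _ => hpos i).ne',
    Real.log_prod fun i _ => (hpos i).ne']
  congr 1
  refine Finset.sum_congr rfl fun i _ => ?_
  by_cases h : s i = 0
  · simp [h]
  · exact Real.log_rpow (norm_pos_iff.2 (hx i h)) _

/-- The function `log⁺ (c |z₁|^{s₁} ⋯ |zₙ|^{sₙ})`. -/
def logPlusMonomial {n : ℕ} (c : ℝ) (s : Fin n → ℝ) (z : Fin n → ℂ) : ℝ :=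
  Real.log (max 1 (c * ∏ i, ‖z i‖ ^ s i))

lemma logPlusMonomial_nonneg {n : ℕ} (c : ℝ) (s : Fin n → ℝ) (z : Fin n → ℂ) :
    0 ≤ logPlusMonomial c s z := Real.log_nonneg (le_max_left _ _)

lemma continuous_mul_prod_rpow {n : ℕ} (c : ℝ) {s : Fin n → ℝ} (hs : ∀ i, 0 ≤ s i) :
    Continuous fun z : Fin n → ℂ => c * ∏ i, ‖z i‖ ^ s i :=
  continuous_const.mul <| continuous_finsetProd _ fun i _ =>
    (continuous_apply i).norm.rpow_const fun _ => Or.inr (hs i)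

lemma continuous_logPlusMonomial {n : ℕ} (c : ℝ) {s : Fin n → ℝ} (hs : ∀ i, 0 ≤ s i) :
    Continuous (logPlusMonomial c s) :=
  (continuous_const.max (continuous_mul_prod_rpow c hs)).log fun _ =>
    (lt_max_of_lt_left one_pos).ne'

lemma le_logPlusMonomial {n : ℕ} {c : ℝ} (hc : 0 < c) {s : Fin n → ℝ} {x : Fin n → ℂ}
    (hx : ∀ i, s i ≠ 0 → x i ≠ 0) :
    Real.log c + ∑ i, s i * Real.log ‖x i‖ ≤ logPlusMonomial c s x := by
  rw [← log_mul_prod_rpow hc hx]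
  refine Real.log_le_log (mul_pos hc (Finset.prod_pos fun i _ => ?_)) (le_max_right _ _)
  by_cases h : s i = 0
  · simp [h]
  · exact Real.rpow_pos_of_pos (norm_pos_iff.2 (hx i h)) _

lemma logPlusMonomial_eq_max {n : ℕ} {c : ℝ} (hc : 0 < c) {s : Fin n → ℝ} {x : Fin n → ℂ}
    (hx : ∀ i, s i ≠ 0 → x i ≠ 0) :
    logPlusMonomial c s x = max 0 (Real.log c + ∑ i, s i * Real.log ‖x i‖) := by
  refine le_antisymm ?_ (max_le (logPlusMonomial_nonneg _ _ _) (le_logPlusMonomial hc hx))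
  rw [← log_mul_prod_rpow hc hx, logPlusMonomial]
  rcases max_choice 1 (c * ∏ i, ‖x i‖ ^ s i) with h | h <;> rw [h]
  · simp
  · exact le_max_right _ _

lemma plurisubharmonic_logPlusMonomial {n : ℕ} {c : ℝ} (hc : 0 < c) {s : Fin n → ℝ}
    (hs : ∀ i, 0 ≤ s i) : Plurisubharmonic (logPlusMonomial c s) := by
  refine ⟨(continuous_logPlusMonomial c hs).upperSemicontinuous, fun a w r hr => ?_⟩
  have hpi : (0 : ℝ) < 2 * Real.pi := by positivity
  rw [le_inv_mul_iff₀ hpi]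
  rcases (logPlusMonomial_nonneg c s a).eq_or_lt with h0 | h0
  · rw [← h0, mul_zero]
    exact intervalIntegral.integral_nonneg hpi.le fun _ _ => logPlusMonomial_nonneg _ _ _
  have ha : ∀ i, s i ≠ 0 → a i ≠ 0 := by
    intro i hi hai
    have : ∏ j, ‖a j‖ ^ s j = 0 :=
      Finset.prod_eq_zero (Finset.mem_univ i) (by rw [hai, norm_zero, Real.zero_rpow hi])
    simp [logPlusMonomial, this] at h0
  rw [logPlusMonomial_eq_max hc ha] at h0 ⊢
  rw [max_eq_right (lt_max_iff.1 h0 |>.resolve_left (lt_irrefl _)).le]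
  have hi : ∀ i, IntervalIntegrable (fun θ : ℝ =>
      s i * Real.log ‖a i + (r * Complex.exp (θ * Complex.I)) * w i‖) volume 0 (2 * Real.pi) :=
    fun i => (intervalIntegrable_log_norm_circle _ _ _).const_mul _
  have hsum : IntervalIntegrable (fun θ : ℝ => ∑ i,
      s i * Real.log ‖a i + (r * Complex.exp (θ * Complex.I)) * w i‖) volume 0 (2 * Real.pi) := by
    have := IntervalIntegrable.sum Finset.univ (fun i _ => hi i)
    simpa [Finset.sum_fn] using this
  calc 2 * Real.pi * (Real.log c + ∑ i, s i * Real.log ‖a i‖)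
      = 2 * Real.pi * Real.log c + ∑ i, s i * (2 * Real.pi * Real.log ‖a i‖) := by
        rw [mul_add, Finset.mul_sum]
        congr 1
        exact Finset.sum_congr rfl fun i _ => by ring
    _ ≤ 2 * Real.pi * Real.log c + ∑ i, s i * ∫ θ in (0 : ℝ)..(2 * Real.pi),
          Real.log ‖a i + (r * Complex.exp (θ * Complex.I)) * w i‖ := by
        refine add_le_add le_rfl (Finset.sum_le_sum fun i _ => ?_)
        by_cases h : s i = 0
        · simp [h]
        · exact mul_le_mul_of_nonneg_left (log_norm_le_integral_circle (ha i h) _ hr) (hs i)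
    _ = ∫ θ in (0 : ℝ)..(2 * Real.pi), (Real.log c +
          ∑ i, s i * Real.log ‖a i + (r * Complex.exp (θ * Complex.I)) * w i‖) := by
        rw [intervalIntegral.integral_add (by simp) hsum,
          intervalIntegral.integral_finsetSum fun i _ => hi i]
        simp [intervalIntegral.integral_const_mul]
    _ ≤ _ := by
        refine intervalIntegral.integral_mono_ae hpi.le (IntervalIntegrable.add (by simp) hsum)
          (((continuous_logPlusMonomial c hs).comp (by fun_prop)).intervalIntegrable _ _) ?_
        have hae : ∀ᵐ θ : ℝ, ∀ i, s i ≠ 0 →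
            a i + (r * Complex.exp (θ * Complex.I)) * w i ≠ 0 := by
          rw [ae_all_iff]
          intro i
          by_cases h : s i = 0
          · simp [h]
          · filter_upwards [ae_add_circle_smul_ne_zero (ha i h) (w i) r] with θ hθ _ using hθ
        filter_upwards [hae] with θ hθ
        exact le_logPlusMonomial hc (x := a + ((r : ℂ) * Complex.exp (θ * Complex.I)) • w) hθ

lemma continuous_dotp_left {n : ℕ} (x : Fin n → ℝ) : Continuous fun s => dotp s x := by
  unfold dotp; fun_prop

lemma dotp_comm {n : ℕ} (x y : Fin n → ℝ) : dotp x y = dotp y x := dotProduct_comm x y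

lemma dotp_add_right {n : ℕ} (s x y : Fin n → ℝ) : dotp s (x + y) = dotp s x + dotp s y :=
  dotProduct_add s x y

lemma dotp_sub_right {n : ℕ} (s x y : Fin n → ℝ) : dotp s (x - y) = dotp s x - dotp s y :=
  dotProduct_sub s x y

lemma dotp_smul_right {n : ℕ} (s x : Fin n → ℝ) (c : ℝ) : dotp s (c • x) = c * dotp s x :=
  dotProduct_smul c s x

lemma bddAbove_image_dotp {n : ℕ} {S : Set (Fin n → ℝ)} (hS : IsCompact S) (x : Fin n → ℝ) :
    BddAbove ((fun s => dotp s x) '' S) :=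
  (hS.image (continuous_dotp_left x)).bddAbove

lemma LogC_eq_of_norm_eq_exp {n : ℕ} {z : Fin n → ℂ} {x : Fin n → ℝ}
    (h : ∀ i, ‖z i‖ = Real.exp (x i)) : LogC z = x := by
  funext i
  simp [LogC, h i]

lemma ne_zero_of_norm_eq_exp {n : ℕ} {z : Fin n → ℂ} {x : Fin n → ℝ}
    (h : ∀ i, ‖z i‖ = Real.exp (x i)) (i : Fin n) : z i ≠ 0 := by
  rw [← norm_pos_iff, h i]
  exact Real.exp_pos _

lemma norm_eq_exp_LogC {n : ℕ} {z : Fin n → ℂ} (hz : ∀ i, z i ≠ 0) (i : Fin n) :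
    ‖z i‖ = Real.exp (LogC z i) := (Real.exp_log (norm_pos_iff.2 (hz i))).symm

/-- A finite-dimensional minimax inequality: if `⟨s, a - x⟩ > t` can be achieved by some `a ∈ A` for
each `s ∈ S`, then it can be achieved by one `a` in the convex hull, uniformly in `s`. -/
lemma exists_mem_convexHull_forall_lt_dotp {n : ℕ} {S A : Set (Fin n → ℝ)} (hS : IsCompact S)
    (hSc : Convex ℝ S) (hne : S.Nonempty) {x : Fin n → ℝ} {t : ℝ}
    (h : ∀ s ∈ S, ∃ a ∈ A, t < dotp s (a - x)) :
    ∃ a ∈ convexHull ℝ A, ∀ s ∈ S, t < dotp s (a - x) := by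
  obtain ⟨F, hFA, hF, hSF⟩ := hS.elim_finite_subcover_image (b := A)
    (c := fun a => {s | t < dotp s (a - x)})
    (fun a _ => isOpen_lt continuous_const (continuous_dotp_left _))
    (fun s hs => by
      obtain ⟨a, ha, hlt⟩ := h s hs
      exact mem_iUnion₂.2 ⟨a, ha, hlt⟩)
  refine Sion.exists_lt_iInf_of_lt_iInf_of_finite (f := fun s a => dotp s (a - x)) hne hS
    (fun a _ => (continuous_dotp_left _).lowerSemicontinuous.lowerSemicontinuousOn _)
    (fun a _ => ConvexOn.quasiconvexOn ⟨hSc, fun s _ s' _ c d _ _ _ => le_of_eq ?_⟩)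
    (convex_convexHull ℝ A)
    (fun s _ => (Continuous.upperSemicontinuous
      (by unfold dotp; fun_prop)).upperSemicontinuousOn _)
    (fun s _ => ConcaveOn.quasiconcaveOn ⟨convex_convexHull ℝ A,
      fun a _ a' _ c d _ _ hcd => le_of_eq ?_⟩) hSc hF
    (hFA.trans (subset_convexHull ℝ A)) fun s hs => ?_
  · dsimp only
    rw [dotp_comm _ (a - x), dotp_comm s, dotp_comm s', dotp_add_right, dotp_smul_right,
      dotp_smul_right, smul_eq_mul, smul_eq_mul]
  · simp only [dotp_sub_right, dotp_add_right, dotp_smul_right, smul_eq_mul]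
    linear_combination (-dotp s x) * hcd
  · obtain ⟨a, ha, hlt⟩ := mem_iUnion₂.1 (hSF hs)
    exact ⟨a, ha, hlt⟩

/-- The logarithmic growth bound `u ≤ H_S + c` together with `u ≤ 0` on the torus over `a` gives
`u z ≤ H_S (Log z - a)`. -/
lemma MemLS.posPart_le_sSup_dotp_sub {n : ℕ} {S : Set (Fin n → ℝ)} (hS : IsCompact S)
    (hS0 : (0 : Fin n → ℝ) ∈ S) {u : (Fin n → ℂ) → ℝ} (hu : MemLS S u) {a : Fin n → ℝ}
    (ha : ∀ w : Fin n → ℂ, (∀ i, ‖w i‖ = Real.exp (a i)) → max (u w) 0 ≤ 0)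
    {z : Fin n → ℂ} (hz : ∀ i, z i ≠ 0) :
    max (u z) 0 ≤ sSup ((fun s => dotp s (LogC z - a)) '' S) := by
  obtain ⟨hpsh, c, hc⟩ := hu
  set φ : (Fin n → ℝ) → ℝ := fun x => sSup ((fun s => dotp s x) '' S) with hφ
  have hle : ∀ x, ∀ s ∈ S, dotp s x ≤ φ x := fun x s hs =>
    le_csSup (bddAbove_image_dotp hS x) ⟨s, hs, rfl⟩
  have hφ0 : ∀ x, 0 ≤ φ x := fun x => by simpa [dotp] using hle x 0 hS0
  refine le_of_forall_pos_le_add fun ε hε => ?_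
  have hM : 0 ≤ φ a + |c| := add_nonneg (hφ0 a) (abs_nonneg c)
  obtain ⟨T, hT⟩ : ∃ T, T = 1 + (φ a + |c|) / ε := ⟨_, rfl⟩
  have hT1 : 1 ≤ T := by
    rw [hT]
    have := div_nonneg hM hε.le
    linarith
  have hT0 : 0 < T := by linarith
  have hMT : φ a + |c| ≤ T * ε := by
    rw [hT, add_mul, div_mul_cancel₀ _ hε.ne']
    linarith
  have hfar : ∀ w : Fin n → ℂ, (∀ i, ‖w i‖ = Real.exp ((a + T • (LogC z - a)) i)) →
      max (u w) 0 ≤ φ a + T * φ (LogC z - a) + |c| := by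
    intro w hw
    have h1 : φ (a + T • (LogC z - a)) ≤ φ a + T * φ (LogC z - a) := by
      refine csSup_le ⟨_, 0, hS0, rfl⟩ ?_
      rintro _ ⟨s, hs, rfl⟩
      dsimp only
      rw [dotp_add_right, dotp_smul_right]
      exact add_le_add (hle _ s hs) (mul_le_mul_of_nonneg_left (hle _ s hs) hT0.le)
    have h2 := hc w (ne_zero_of_norm_eq_exp hw)
    rw [LogC_eq_of_norm_eq_exp hw] at h2
    change u w ≤ φ _ + c at h2
    have h3 := hφ0 (a + T • (LogC z - a))
    exact max_le (by linarith [le_abs_self c]) (by linarith [abs_nonneg c])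
  have key := hpsh.posPart_le_lineMap (t := T⁻¹) (z := z) ha hfar (by positivity)
    (inv_le_one_of_one_le₀ hT1) fun i => by
      rw [norm_eq_exp_LogC hz i]
      congr 1
      simp only [Pi.add_apply, Pi.smul_apply, Pi.sub_apply, smul_eq_mul]
      field_simp
      ring
  refine key.trans ?_
  rw [mul_zero, zero_add, inv_mul_le_iff₀ hT0]
  change _ ≤ T * (φ (LogC z - a) + ε)
  linarith

/-- The set of logarithmic coordinates of tori on which a plurisubharmonic function is nonpositive
is convex. -/
lemma Plurisubharmonic.convex_setOf_torus_nonpos {n : ℕ} {u : (Fin n → ℂ) → ℝ}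
    (hu : Plurisubharmonic u) :
    Convex ℝ {a : Fin n → ℝ |
      ∀ w : Fin n → ℂ, (∀ i, ‖w i‖ = Real.exp (a i)) → max (u w) 0 ≤ 0} := by
  intro p hp q hq c d hc hd hcd w hw
  have := hu.posPart_le_lineMap hp hq hd (by linarith) (z := w) fun i => by
    rw [hw i]
    congr 1
    simp only [Pi.add_apply, Pi.smul_apply, smul_eq_mul]
    linear_combination p i * hcd
  simpa using this

lemma MemLS.le_sSup {n : ℕ} {S : Set (Fin n → ℝ)}
    (hScomp : IsCompact S) (hSconv : Convex ℝ S) (hS0 : (0 : Fin n → ℝ) ∈ S)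
    {K : Set (Fin n → ℂ)}
    (hKrein : ∀ z ∈ K, ∀ ζ : Fin n → ℂ, (∀ i, ‖ζ i‖ = 1) → (fun i => ζ i * z i) ∈ K)
    (hKne : (K ∩ {z | ∀ i, z i ≠ 0}).Nonempty)
    (hbdd : ∀ s ∈ S, BddAbove ((fun a => dotp a s) '' (LogC '' (K ∩ {z | ∀ i, z i ≠ 0}))))
    {u : (Fin n → ℂ) → ℝ} (hu : MemLS S u) (huK : ∀ w ∈ K, u w ≤ 0)
    {z : Fin n → ℂ} (hz : ∀ i, z i ≠ 0) :
    u z ≤ sSup ((fun s => dotp s (LogC z) -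
        sSup ((fun a => dotp a s) '' (LogC '' (K ∩ {z | ∀ i, z i ≠ 0})))) '' S) := by
  set A := LogC '' (K ∩ {z | ∀ i, z i ≠ 0}) with hA
  have hAne : A.Nonempty := hKne.image _
  have hR : BddAbove ((fun s => dotp s (LogC z) - sSup ((fun a => dotp a s) '' A)) '' S) := by
    obtain ⟨a, ha⟩ := hAne
    obtain ⟨M, hM⟩ := bddAbove_image_dotp hScomp (LogC z - a)
    refine ⟨M, ?_⟩
    rintro _ ⟨s, hs, rfl⟩
    have h1 := hM ⟨s, hs, rfl⟩
    have h2 := le_csSup (hbdd s hs) ⟨a, ha, rfl⟩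
    dsimp only at h1 h2 ⊢
    rw [dotp_sub_right, dotp_comm s a] at h1
    linarith
  refine le_of_forall_gt_imp_ge_of_dense fun t ht => ?_
  obtain ⟨a, ha, hlt⟩ := exists_mem_convexHull_forall_lt_dotp (A := A) (x := LogC z) (t := -t)
    hScomp hSconv ⟨0, hS0⟩ fun s hs => by
      by_contra! hcon
      have h1 : sSup ((fun a => dotp a s) '' A) ≤ dotp s (LogC z) - t := by
        refine csSup_le (hAne.image _) ?_
        rintro _ ⟨a, ha, rfl⟩
        have := hcon a ha
        dsimp only
        rw [dotp_sub_right] at this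
        rw [dotp_comm]
        linarith
      have h2 := le_csSup hR ⟨s, hs, rfl⟩
      dsimp only at h2
      linarith
  have hsub : convexHull ℝ A ⊆ {a : Fin n → ℝ |
      ∀ w : Fin n → ℂ, (∀ i, ‖w i‖ = Real.exp (a i)) → max (u w) 0 ≤ 0} := by
    refine convexHull_min ?_ hu.1.convex_setOf_torus_nonpos
    rintro _ ⟨v, ⟨hvK, hv⟩, rfl⟩ w hw
    refine max_le (huK w ?_) le_rfl
    have := hKrein v hvK (fun i => w i / v i) fun i => by
      rw [norm_div, hw i, ← norm_eq_exp_LogC hv i, div_self (norm_ne_zero_iff.2 (hv i))]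
    simpa [div_mul_cancel₀ _ (hv _)] using this
  calc u z ≤ max (u z) 0 := le_max_left _ _
    _ ≤ sSup ((fun s => dotp s (LogC z - a)) '' S) :=
      hu.posPart_le_sSup_dotp_sub hScomp hS0 (hsub ha) hz
    _ ≤ t := by
      refine csSup_le ⟨_, 0, hS0, rfl⟩ ?_
      rintro _ ⟨s, hs, rfl⟩
      have := hlt s hs
      dsimp only
      rw [dotp_sub_right] at this ⊢
      linarith

lemma bddAbove_image_dotp_LogC {n : ℕ} {K : Set (Fin n → ℂ)} (hK : IsCompact K)
    {s : Fin n → ℝ} (hs : ∀ i, 0 ≤ s i) :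
    BddAbove ((fun a => dotp a s) '' (LogC '' (K ∩ {z | ∀ i, z i ≠ 0}))) := by
  obtain ⟨R, hR⟩ := hK.isBounded.exists_norm_le
  refine ⟨∑ i, R * s i, ?_⟩
  rintro _ ⟨_, ⟨z, ⟨hz, -⟩, rfl⟩, rfl⟩
  refine Finset.sum_le_sum fun i _ => mul_le_mul_of_nonneg_right ?_ (hs i)
  exact (Real.log_le_self (norm_nonneg _)).trans ((norm_le_pi_norm z i).trans (hR z hz))

lemma memLS_logPlusMonomial {n : ℕ} {S : Set (Fin n → ℝ)} (hS : IsCompact S)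
    (hS0 : (0 : Fin n → ℝ) ∈ S) {s : Fin n → ℝ} (hs : s ∈ S) (hpos : ∀ i, 0 ≤ s i) {c : ℝ}
    (hc : 0 < c) : MemLS S (logPlusMonomial c s) := by
  refine ⟨plurisubharmonic_logPlusMonomial hc hpos, |Real.log c|, fun z hz => ?_⟩
  have h1 := le_csSup (bddAbove_image_dotp hS (LogC z)) ⟨s, hs, rfl⟩
  have h2 := le_csSup (bddAbove_image_dotp hS (LogC z)) ⟨0, hS0, rfl⟩
  rw [logPlusMonomial_eq_max hc fun i _ => hz i]
  simp only [dotp, LogC, Pi.zero_apply, zero_mul, Finset.sum_const_zero] at h1 h2 ⊢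
  exact max_le (by linarith [abs_nonneg (Real.log c)]) (by linarith [le_abs_self (Real.log c)])

lemma logPlusMonomial_nonpos_of_mem {n : ℕ} {K : Set (Fin n → ℂ)}
    (hKcl : K = closure (K ∩ {z | ∀ i, z i ≠ 0})) {s : Fin n → ℝ} (hpos : ∀ i, 0 ≤ s i)
    {c : ℝ} (hc : 0 < c) (h : ∀ z ∈ K ∩ {z | ∀ i, z i ≠ 0}, Real.log c + dotp s (LogC z) ≤ 0) :
    ∀ w ∈ K, logPlusMonomial c s w ≤ 0 := by
  intro w hw
  rw [hKcl] at hw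
  refine closure_minimal (t := {w | logPlusMonomial c s w ≤ 0}) (fun z hz => ?_)
    (isClosed_le (continuous_logPlusMonomial c hpos) continuous_const) hw
  change logPlusMonomial c s z ≤ 0
  rw [logPlusMonomial_eq_max hc fun i _ => hz.2 i]
  exact max_le le_rfl (h z hz)

/-- For a compact Reinhardt set K with K = closure(K ∩ (ℂ*)ⁿ)
    and A = Log(K ∩ (ℂ*)ⁿ) nonempty, for all z ∈ (ℂ*)ⁿ,
    V^S_K(z) = sup_{s∈S}(⟨s, Log z⟩ − φ_A(s)). -/
theorem VSZ_formula_reinhardt (n : ℕ) (S : Set (Fin n → ℝ))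
    (hScomp : IsCompact S) (hSconv : Convex ℝ S) (hS0 : (0 : Fin n → ℝ) ∈ S)
    (hSpos : ∀ s ∈ S, ∀ i, 0 ≤ s i)
    (K : Set (Fin n → ℂ)) (hK : IsCompact K)
    (hKrein : ∀ z ∈ K, ∀ ζ : Fin n → ℂ, (∀ i, ‖ζ i‖ = 1) →
      (fun i => ζ i * z i) ∈ K)
    (hKne : (K ∩ {z | ∀ i, z i ≠ 0}).Nonempty)
    (hKcl : K = closure (K ∩ {z | ∀ i, z i ≠ 0})) :
    ∀ z : Fin n → ℂ, (∀ i, z i ≠ 0) →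
      VSZ S K z = sSup ((fun s => dotp s (LogC z) -
        sSup ((fun a => dotp a s) '' (LogC '' (K ∩ {z | ∀ i, z i ≠ 0})))) '' S) := by
  intro z hz
  set A := LogC '' (K ∩ {z | ∀ i, z i ≠ 0}) with hA
  have hbdd : ∀ s ∈ S, BddAbove ((fun a => dotp a s) '' A) := fun s hs =>
    bddAbove_image_dotp_LogC hK (hSpos s hs)
  have hub : ∀ t ∈ {t : ℝ | ∃ u, MemLS S u ∧ (∀ w ∈ K, u w ≤ 0) ∧ t = u z},
      t ≤ sSup ((fun s => dotp s (LogC z) - sSup ((fun a => dotp a s) '' A)) '' S) := by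
    rintro _ ⟨u, hu, huK, rfl⟩
    exact hu.le_sSup hScomp hSconv hS0 hKrein hKne hbdd huK hz
  have hlb : ∀ s ∈ S, ∃ t ∈ {t : ℝ | ∃ u, MemLS S u ∧ (∀ w ∈ K, u w ≤ 0) ∧ t = u z},
      dotp s (LogC z) - sSup ((fun a => dotp a s) '' A) ≤ t := by
    intro s hs
    set φ := sSup ((fun a => dotp a s) '' A)
    have hle : Real.log (Real.exp (-φ)) + dotp s (LogC z) ≤
        logPlusMonomial (Real.exp (-φ)) s z := le_logPlusMonomial (Real.exp_pos _) fun i _ => hz i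
    rw [Real.log_exp] at hle
    refine ⟨_, ⟨_, memLS_logPlusMonomial hScomp hS0 hs (hSpos s hs) (Real.exp_pos (-φ)),
      logPlusMonomial_nonpos_of_mem hKcl (hSpos s hs) (Real.exp_pos _) fun w hw => ?_, rfl⟩,
      by linarith⟩
    have h1 : dotp (LogC w) s ≤ φ := le_csSup (hbdd s hs) ⟨_, ⟨w, hw, rfl⟩, rfl⟩
    rw [Real.log_exp, dotp_comm]
    linarith
  obtain ⟨t₀, ht₀, -⟩ := hlb 0 hS0
  refine le_antisymm (csSup_le ⟨t₀, ht₀⟩ hub) (csSup_le ⟨_, 0, hS0, rfl⟩ ?_)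
  rintro _ ⟨s, hs, rfl⟩
  obtain ⟨t, ht, hle⟩ := hlb s hs
  exact hle.trans (le_csSup ⟨_, hub⟩ ht)
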